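/- Suppose m ≥ 2 is even. Then the weight distribution of C_D is: #{a ∈ F_r : wt(c_a) = (p−1)²p^{m−2}/2} = p^{m−1} − 1; #{a ∈ F_r : wt(c_a) = ((p−1)/2)((p−1)p^{m−2} + p^{(m−2)/2})} = ((p−1)/2)(p^{m−1} + p^{(m−2)/2}); #{a ∈ F_r : wt(c_a) = ((p−1)/2)((p−1)p^{m−2} − p^{(m−2)/2})} = ((p−1)/2)(p^{m−1} − p^{(m−2)/2}); #{a ∈ F_r : wt(c_a) = 0} = 1; and no other Hamming weight occurs. -/

import Mathlib

/-- The Hamming weight `wt(c_a) = #{x ∈ D : Tr(a x²) ≠ 0}` of the codeword of `C_D`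
indexed by `a`, where `D = {x ∈ F_r^* : Tr(x) ∈ Sq}`. -/
noncomputable def wtD (p : ℕ) (F : Type) [Field F] [Algebra (ZMod p) F] (a : F) : ℕ :=
  Set.ncard {x : F | (x ≠ 0 ∧ IsSquare (Algebra.trace (ZMod p) F x) ∧
    Algebra.trace (ZMod p) F x ≠ 0) ∧ Algebra.trace (ZMod p) F (a * x ^ 2) ≠ 0}

set_option linter.all false
open Finset

theorem aux_quadsum {F : Type} [Field F] [Fintype F] [DecidableEq F] (hF : ringChar F ≠ 2)
    (χ : AddChar F ℂ) (hχ : χ.IsPrimitive) (b : F) (hb : b ≠ 0) :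
    ∑ x : F, χ (b * x ^ 2) =
      ((quadraticChar F b : ℤ) : ℂ) * ∑ t : F, ((quadraticChar F t : ℤ) : ℂ) * χ t := by
  have h1 : ∑ x : F, χ (b * x ^ 2) = ∑ t : F, (((quadraticChar F t : ℤ) : ℂ) + 1) * χ (b * t) := by
    rw [← Finset.sum_fiberwise (s := univ) (g := fun x : F => x ^ 2)]
    refine Finset.sum_congr rfl fun t _ => ?_
    have h2 := quadraticChar_card_sqrts hF t
    have h3 : ({x : F | x ^ 2 = t} : Set F).toFinset = univ.filter (fun x : F => x ^ 2 = t) := by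
      ext; simp
    rw [h3] at h2
    rw [Finset.sum_congr rfl (g := fun _ => χ (b * t))]
    · rw [Finset.sum_const, nsmul_eq_mul]
      congr 1
      exact_mod_cast h2
    · intro x hx
      rw [(Finset.mem_filter.1 hx).2]
  have h4 : ∑ t : F, χ (b * t) = 0 := by
    have := AddChar.sum_mulShift b hχ
    simp only [hb, if_false] at this
    simpa [mul_comm] using this
  rw [h1]
  simp only [add_mul, one_mul, Finset.sum_add_distrib, h4, add_zero]
  rw [Finset.mul_sum]
  refine Fintype.sum_equiv (Equiv.mulLeft₀ b hb) _ _ fun t => ?_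
  have h5 : (quadraticChar F b) * (quadraticChar F (b * t)) = quadraticChar F t := by
    rw [map_mul, ← mul_assoc, ← sq, quadraticChar_sq_one hb, one_mul]
  simp only [Equiv.mulLeft₀_apply]
  rw [← mul_assoc, ← Int.cast_mul, h5]

theorem aux_quadsum2 {F : Type} [Field F] [Fintype F] [DecidableEq F] (hF : ringChar F ≠ 2)
    (χ : AddChar F ℂ) (hχ : χ.IsPrimitive) (b c : F) (hb : b ≠ 0) :
    ∑ x : F, χ (b * x ^ 2 + c * x) =
      χ (-(c ^ 2 / (4 * b))) * (((quadraticChar F b : ℤ) : ℂ) *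
        ∑ t : F, ((quadraticChar F t : ℤ) : ℂ) * χ t) := by
  have h2 : (2 : F) ≠ 0 := Ring.two_ne_zero hF
  have h4 : (4 : F) ≠ 0 := by
    have : (4 : F) = 2 * 2 := by norm_num
    rw [this]; exact mul_ne_zero h2 h2
  rw [← aux_quadsum hF χ hχ b hb, Finset.mul_sum]
  refine Fintype.sum_equiv (Equiv.addRight (c / (2 * b))) _ _ fun t => ?_
  rw [← AddChar.map_add_eq_mul]
  congr 1
  simp only [Equiv.coe_addRight]
  field_simp
  ring

theorem aux_sq {p m : ℕ} [Fact p.Prime] (hp2 : p ≠ 2) (hme : Even m)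
    {F : Type} [Field F] [Fintype F] [DecidableEq F] [Algebra (ZMod p) F]
    (hcard : Fintype.card F = p ^ m) (hF : ringChar F ≠ 2) (y : ZMod p) (hy : y ≠ 0) :
    quadraticChar F (algebraMap (ZMod p) F y) = 1 := by
  have hy' : algebraMap (ZMod p) F y ≠ 0 := by simpa using hy
  rw [quadraticChar_one_iff_isSquare hy', FiniteField.isSquare_iff hF hy', ← map_pow, hcard]
  obtain ⟨k, rfl⟩ := hme
  have hodd : Odd p := (Fact.out : p.Prime).odd_of_ne_two hp2
  obtain ⟨q, hq⟩ := hodd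
  have h1 : (p - 1) ∣ p ^ (k + k) / 2 := by
    rw [← two_mul, pow_mul]
    have h2 : p ^ 2 - 1 ∣ (p ^ 2) ^ k - 1 := by simpa using Nat.sub_dvd_pow_sub_pow (p ^ 2) 1 k
    obtain ⟨c, hc⟩ := h2
    have h3 : (p ^ 2) ^ k = 2 * ((p - 1) * ((q + 1) * c)) + 1 := by
      have : 1 ≤ (p ^ 2) ^ k := Nat.one_le_pow _ _ (by subst hq; positivity)
      have h5 : p ^ 2 - 1 = 2 * ((p - 1) * (q + 1)) := by
        subst hq
        simp only [Nat.add_sub_cancel]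
        have : (2 * q + 1) ^ 2 = 2 * (2 * q * (q + 1)) + 1 := by ring
        omega
      rw [h5] at hc
      have : 2 * ((p - 1) * (q + 1)) * c = 2 * ((p - 1) * ((q + 1) * c)) := by ring
      omega
    rw [h3]
    refine ⟨(q + 1) * c, by omega⟩
  obtain ⟨c, hc⟩ := h1
  rw [hc, pow_mul, ZMod.pow_card_sub_one_eq_one hy, one_pow, map_one]

/-- the Gauss sum -/
noncomputable def auxG {p : ℕ} {F : Type} [Field F] [Fintype F] [DecidableEq F] [Algebra (ZMod p) F]
    (ψ : AddChar (ZMod p) ℂ) : ℂ :=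
  ∑ t : F, ((quadraticChar F t : ℤ) : ℂ) * ψ (Algebra.trace (ZMod p) F t)

section
variable {p m : ℕ} [Fact p.Prime]
    {F : Type} [Field F] [Fintype F] [DecidableEq F] [Algebra (ZMod p) F]

theorem aux_surj : Function.Surjective (Algebra.trace (ZMod p) F) :=
  Algebra.trace_surjective (ZMod p) F

/-- the character of F -/
noncomputable def auxχ (F : Type) [Field F] [Algebra (ZMod p) F] (ψ : AddChar (ZMod p) ℂ) : AddChar F ℂ :=
  ψ.compAddMonoidHom (Algebra.trace (ZMod p) F).toAddMonoidHom

theorem auxχ_apply (ψ : AddChar (ZMod p) ℂ) (x : F) :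
    auxχ F ψ x = ψ (Algebra.trace (ZMod p) F x) := rfl

theorem auxχ_prim (ψ : AddChar (ZMod p) ℂ) (hψ : ψ.IsPrimitive) : (auxχ F ψ).IsPrimitive := by
  apply AddChar.IsPrimitive.of_ne_one
  intro h
  have h1 := hψ (one_ne_zero)
  apply h1
  ext y
  obtain ⟨x, rfl⟩ := aux_surj (F := F) y
  have := DFunLike.congr_fun h x
  simpa [auxχ_apply] using this

theorem aux_char (hp2 : p ≠ 2) : ringChar F ≠ 2 := by
  have : CharP F p := charP_of_injective_algebraMap (algebraMap (ZMod p) F).injective p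
  rw [ringChar.eq F p]; exact hp2

theorem aux_G (hp2 : p ≠ 2) (hme : Even m) (hcard : Fintype.card F = p ^ m)
    (ψ : AddChar (ZMod p) ℂ) (hψ : ψ.IsPrimitive) : (auxG (F := F) ψ) ^ 2 = (p : ℂ) ^ m := by
  have hF : ringChar F ≠ 2 := aux_char hp2
  have h := gaussSum_sq (R := F) (χ := (quadraticChar F).ringHomComp (Int.castRingHom ℂ))
    (by
      rw [Ne, MulChar.ringHomComp_eq_one_iff]
      · exact quadraticChar_ne_one hF
      · exact Int.cast_injective) ((quadraticChar_isQuadratic F).comp _) (auxχ_prim ψ hψ)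
  have h1 : quadraticChar F (-1) = 1 := by
    simpa using aux_sq hp2 hme hcard hF (-1) (by simp)
  rw [hcard] at h
  simp only [MulChar.ringHomComp_apply, h1] at h
  simpa [gaussSum, auxG, auxχ_apply] using h

theorem aux_inner (hp2 : p ≠ 2) (ψ : AddChar (ZMod p) ℂ) (hψ : ψ.IsPrimitive) (c : ZMod p) :
    ∑ y ∈ univ.erase (0 : ZMod p), ψ (-(c / (4 * y))) = (if c = 0 then (p : ℂ) else 0) - 1 := by
  have h2 : (2 : ZMod p) ≠ 0 := Ring.two_ne_zero (by rw [ZMod.ringChar_zmod_n]; exact hp2)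
  have h4 : (-4 : ZMod p) ≠ 0 := by
    have : (-4 : ZMod p) = -(2 * 2) := by norm_num
    rw [this]; exact neg_ne_zero.2 (mul_ne_zero h2 h2)
  have h := AddChar.sum_mulShift c hψ
  rw [ZMod.card] at h
  rw [eq_sub_iff_add_eq, ← Finset.sum_erase_add _ _ (mem_univ (0 : ZMod p))] at *
  have h5 : ∑ y : ZMod p, ψ (-(c / (4 * y))) = ∑ w : ZMod p, ψ (w * c) := by
    refine Fintype.sum_equiv ((Equiv.mulLeft₀ (-4) h4).trans (Equiv.inv _)) _ _ fun t => ?_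
    congr 1
    simp [div_eq_mul_inv]
    ring
  rw [← Finset.sum_erase_add _ _ (mem_univ (0 : ZMod p)),
    ← Finset.sum_erase_add _ _ (mem_univ (0 : ZMod p))] at h5
  simp only [mul_zero, div_zero, neg_zero, AddChar.map_zero_eq_one, zero_mul] at h5 h
  rw [h5, h]
  split_ifs <;> simp

theorem aux_double (hp2 : p ≠ 2) (ψ : AddChar (ZMod p) ℂ) (hψ : ψ.IsPrimitive) (s T : ZMod p)
    (hs : s ≠ 0) :
    ∑ y ∈ univ.erase (0 : ZMod p), ∑ z : ZMod p, ψ (z * (-s)) * ψ (-(z ^ 2 * T / (4 * y))) =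
      if T = 0 then 0 else (p : ℂ) := by
  rw [Finset.sum_comm]
  simp only [← Finset.mul_sum, aux_inner hp2 ψ hψ, mul_sub, Finset.sum_sub_distrib, mul_one]
  rw [AddChar.sum_mulShift _ hψ]
  simp only [neg_eq_zero, hs, if_false]
  by_cases hT : T = 0
  · simp only [hT, mul_zero, if_true]
    rw [← Finset.sum_mul, AddChar.sum_mulShift _ hψ]
    simp [hs]
  · simp [hT]

theorem aux_N (hp2 : p ≠ 2) (hme : Even m) (hcard : Fintype.card F = p ^ m)
    (ψ : AddChar (ZMod p) ℂ) (hψ : ψ.IsPrimitive) (a : F) (ha : a ≠ 0) (s : ZMod p) (hs : s ≠ 0) :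
    (p : ℂ) ^ 2 * ((univ.filter fun x : F => Algebra.trace (ZMod p) F x = s ∧
      Algebra.trace (ZMod p) F (a * x ^ 2) = 0).card : ℂ) =
    (p : ℂ) ^ m + (if Algebra.trace (ZMod p) F a⁻¹ = 0 then 0 else (p : ℂ)) *
      (((quadraticChar F a : ℤ) : ℂ) * auxG (F := F) ψ) := by
  have hF : ringChar F ≠ 2 := aux_char hp2
  set Tr := Algebra.trace (ZMod p) F with hTr
  have key : ∀ y z : ZMod p, y ≠ 0 → ∑ x : F, ψ (y * Tr (a * x ^ 2)) * ψ (z * Tr x) =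
      ψ (-(z ^ 2 * Tr a⁻¹ / (4 * y))) * (((quadraticChar F a : ℤ) : ℂ) * auxG (F := F) ψ) := by
    intro y z hy
    have hy' : algebraMap (ZMod p) F y ≠ 0 := by simpa using hy
    have h := aux_quadsum2 hF (auxχ F ψ) (auxχ_prim ψ hψ) (algebraMap (ZMod p) F y * a)
      (algebraMap (ZMod p) F z) (mul_ne_zero hy' ha)
    rw [map_mul, aux_sq hp2 hme hcard hF y hy, one_mul] at h
    simp only [auxχ_apply] at h
    rw [auxG]
    convert h using 2
    · rename_i x _
      rw [← AddChar.map_add_eq_mul, mul_assoc, (Algebra.trace (ZMod p) F).map_add, ← Algebra.smul_def, ← Algebra.smul_def,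
        map_smul, map_smul, smul_eq_mul, smul_eq_mul]
    · congr 1
      have : -(algebraMap (ZMod p) F z ^ 2 / (4 * (algebraMap (ZMod p) F y * a))) =
        (-(z ^ 2 / (4 * y))) • a⁻¹ := by
        have e4 : algebraMap (ZMod p) F 4 = 4 := map_ofNat _ 4
        rw [Algebra.smul_def]
        simp [e4, div_eq_mul_inv]
        ring
      rw [this, map_smul, smul_eq_mul]
      ring
  have key0 : ∀ z : ZMod p, ∑ x : F, ψ (0 * Tr (a * x ^ 2)) * ψ (z * Tr x) =
      if z = 0 then (p : ℂ) ^ m else 0 := by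
    intro z
    have h := AddChar.sum_mulShift (algebraMap (ZMod p) F z) (auxχ_prim (F := F) ψ hψ)
    rw [hcard] at h
    simp only [auxχ_apply] at h
    simp only [zero_mul, AddChar.map_zero_eq_one, one_mul]
    have e : ∀ x : F, Algebra.trace (ZMod p) F (x * algebraMap (ZMod p) F z) = z * Tr x := by
      intro x
      rw [mul_comm, ← Algebra.smul_def, map_smul, smul_eq_mul]
    simp only [e] at h
    rw [h]
    simp
  have h1 : (p : ℂ) ^ 2 * ((univ.filter fun x : F => Tr x = s ∧ Tr (a * x ^ 2) = 0).card : ℂ) =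
      ∑ x : F, (∑ y : ZMod p, ψ (y * Tr (a * x ^ 2))) * ∑ z : ZMod p, ψ (z * (Tr x - s)) := by
    rw [Finset.card_filter]
    push_cast
    rw [Finset.mul_sum]
    refine Finset.sum_congr rfl fun x _ => ?_
    rw [AddChar.sum_mulShift _ hψ, AddChar.sum_mulShift _ hψ, ZMod.card]
    simp only [sub_eq_zero]
    by_cases h1 : Tr x = s <;> by_cases h2 : Tr (a * x ^ 2) = 0 <;> simp [h1, h2]
    ring
  have h2 : ∑ x : F, (∑ y : ZMod p, ψ (y * Tr (a * x ^ 2))) * ∑ z : ZMod p, ψ (z * (Tr x - s)) =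
      ∑ y : ZMod p, ∑ z : ZMod p, ψ (z * (-s)) * ∑ x : F, ψ (y * Tr (a * x ^ 2)) * ψ (z * Tr x) := by
    simp only [Finset.sum_mul_sum]
    rw [Finset.sum_comm]
    refine Finset.sum_congr rfl fun y _ => ?_
    rw [Finset.sum_comm]
    refine Finset.sum_congr rfl fun z _ => ?_
    rw [Finset.mul_sum]
    refine Finset.sum_congr rfl fun x _ => ?_
    rw [sub_eq_add_neg, mul_add, AddChar.map_add_eq_mul]
    ring
  rw [h1, h2, ← Finset.sum_erase_add _ _ (mem_univ (0 : ZMod p)), add_comm]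
  congr 1
  · simp only [key0]
    simp
  · rw [← aux_double hp2 ψ hψ s _ hs, Finset.sum_mul]
    refine Finset.sum_congr rfl fun y hy => ?_
    rw [Finset.sum_mul]
    refine Finset.sum_congr rfl fun z _ => ?_
    rw [key y z (Finset.ne_of_mem_erase hy)]
    ring

theorem aux_fib (hcard : Fintype.card F = p ^ m) (ψ : AddChar (ZMod p) ℂ) (hψ : ψ.IsPrimitive)
    (s : ZMod p) :
    (p : ℂ) * ((univ.filter fun x : F => Algebra.trace (ZMod p) F x = s).card : ℂ) = (p : ℂ) ^ m := by
  have h1 : (p : ℂ) * ((univ.filter fun x : F => Algebra.trace (ZMod p) F x = s).card : ℂ) =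
      ∑ x : F, ∑ z : ZMod p, ψ (z * (Algebra.trace (ZMod p) F x - s)) := by
    rw [Finset.card_filter]
    push_cast
    rw [Finset.mul_sum]
    refine Finset.sum_congr rfl fun x _ => ?_
    rw [AddChar.sum_mulShift _ hψ, ZMod.card]
    simp [sub_eq_zero]
  rw [h1, Finset.sum_comm]
  have h2 : ∀ z : ZMod p, ∑ x : F, ψ (z * (Algebra.trace (ZMod p) F x - s)) =
      if z = 0 then (p : ℂ) ^ m else 0 := by
    intro z
    have h := AddChar.sum_mulShift (algebraMap (ZMod p) F z) (auxχ_prim (F := F) ψ hψ)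
    rw [hcard] at h
    simp only [auxχ_apply] at h
    have e : ∀ x : F, Algebra.trace (ZMod p) F (x * algebraMap (ZMod p) F z) =
        z * Algebra.trace (ZMod p) F x := by
      intro x
      rw [mul_comm, ← Algebra.smul_def, map_smul, smul_eq_mul]
    simp only [e] at h
    simp only [sub_eq_add_neg, mul_add, AddChar.map_add_eq_mul]
    rw [← Finset.sum_mul, h]
    by_cases hz : z = 0 <;> simp [hz]
  simp [h2]

/-- sum of the quadratic character over trace zero elements -/
theorem aux_etasum (hp2 : p ≠ 2) (hme : Even m) (hcard : Fintype.card F = p ^ m)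
    (ψ : AddChar (ZMod p) ℂ) (hψ : ψ.IsPrimitive) :
    (p : ℂ) * ∑ x ∈ univ.filter (fun x : F => Algebra.trace (ZMod p) F x⁻¹ = 0),
      ((quadraticChar F x : ℤ) : ℂ) = ((p : ℂ) - 1) * auxG (F := F) ψ := by
  have hF : ringChar F ≠ 2 := aux_char hp2
  have h0 : ∑ x ∈ univ.filter (fun x : F => Algebra.trace (ZMod p) F x⁻¹ = 0),
      ((quadraticChar F x : ℤ) : ℂ) = ∑ x ∈ univ.filter (fun x : F => Algebra.trace (ZMod p) F x = 0),
      ((quadraticChar F x : ℤ) : ℂ) := by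
    rw [Finset.sum_filter, Finset.sum_filter]
    refine Fintype.sum_equiv (Equiv.inv _) _ _ fun x => ?_
    have : quadraticChar F x⁻¹ = quadraticChar F x := by
      by_cases hx : x = 0
      · simp [hx]
      · have h1 : quadraticChar F x⁻¹ * quadraticChar F x = 1 := by
          rw [← map_mul, inv_mul_cancel₀ hx, map_one]
        rcases quadraticChar_dichotomy hx with h | h <;> rw [h] at h1 ⊢ <;> linarith
    simp only [Equiv.inv_apply, this]
  have h1 : (p : ℂ) * ∑ x ∈ univ.filter (fun x : F => Algebra.trace (ZMod p) F x = 0),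
      ((quadraticChar F x : ℤ) : ℂ) =
      ∑ x : F, ∑ z : ZMod p, ((quadraticChar F x : ℤ) : ℂ) * ψ (z * (Algebra.trace (ZMod p) F x)) := by
    rw [Finset.sum_filter, Finset.mul_sum]
    refine Finset.sum_congr rfl fun x _ => ?_
    rw [← Finset.mul_sum, AddChar.sum_mulShift _ hψ, ZMod.card]
    split_ifs <;> simp [mul_comm]
  rw [h0, h1, Finset.sum_comm, ← Finset.sum_erase_add _ _ (mem_univ (0 : ZMod p))]
  have h3 : ∑ x : F, ((quadraticChar F x : ℤ) : ℂ) * ψ (0 * (Algebra.trace (ZMod p) F x)) = 0 := by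
    simp only [zero_mul, AddChar.map_zero_eq_one, mul_one]
    exact_mod_cast quadraticChar_sum_zero hF
  rw [h3, add_zero, Finset.sum_congr rfl (g := fun _ => auxG (F := F) ψ)]
  · rw [Finset.sum_const, Finset.card_erase_of_mem (mem_univ _), Finset.card_univ, ZMod.card,
      nsmul_eq_mul, Nat.cast_sub (Fact.out : p.Prime).one_le, Nat.cast_one]
  · intro z hz
    have hz0 := Finset.ne_of_mem_erase hz
    have hz' : algebraMap (ZMod p) F z ≠ 0 := by simpa using hz0
    rw [auxG]
    refine Fintype.sum_equiv (Equiv.mulLeft₀ _ hz') _ _ fun x => ?_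
    simp only [Equiv.mulLeft₀_apply]
    rw [map_mul (quadraticChar F), aux_sq hp2 hme hcard hF z hz0, one_mul, ← Algebra.smul_def, map_smul, smul_eq_mul]

theorem aux_cardsq (hp2 : p ≠ 2) :
    (univ.filter fun s : ZMod p => IsSquare s ∧ s ≠ 0).card = (p - 1) / 2 := by
  have hF : ringChar (ZMod p) ≠ 2 := by rw [ZMod.ringChar_zmod_n]; exact hp2
  have h0 := quadraticChar_sum_zero hF
  have h1 : ∀ s : ZMod p, quadraticChar (ZMod p) s =
      2 * (if IsSquare s ∧ s ≠ 0 then 1 else 0) - (if s ≠ 0 then 1 else 0) := by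
    intro s
    by_cases hs : s = 0
    · simp [hs]
    · by_cases h : IsSquare s
      · rw [(quadraticChar_one_iff_isSquare hs).2 h]; simp [h, hs]
      · rw [quadraticChar_neg_one_iff_not_isSquare.2 h]; simp [h, hs]
  simp only [h1, Finset.sum_sub_distrib, ← Finset.mul_sum] at h0
  rw [← Finset.natCast_card_filter, ← Finset.natCast_card_filter, Finset.filter_ne',
    Finset.card_erase_of_mem (mem_univ _), Finset.card_univ, ZMod.card] at h0
  omega

theorem aux_main (hp2 : p ≠ 2) (k : ℕ) (hcard : Fintype.card F = p ^ (2 * k + 2)) :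
    ∃ ε : ℤ, (ε = 1 ∨ ε = -1) ∧
      (∀ a : F, a ≠ 0 → (wtD p F a : ℤ) = ((p - 1) / 2 : ℕ) * (((p : ℤ) - 1) * (p ^ k) ^ 2 -
        (if Algebra.trace (ZMod p) F a⁻¹ = 0 then 0 else quadraticChar F a * ε * p ^ k))) ∧
      ∑ x ∈ univ.filter (fun x : F => Algebra.trace (ZMod p) F x⁻¹ = 0), quadraticChar F x =
        ((p : ℤ) - 1) * ε * p ^ k ∧
      (univ.filter (fun x : F => Algebra.trace (ZMod p) F x⁻¹ = 0)).card = p * (p ^ k) ^ 2 := by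
  have hp0 : (p : ℂ) ≠ 0 := by exact_mod_cast (Fact.out : p.Prime).ne_zero
  have hme : Even (2 * k + 2) := ⟨k + 1, by ring⟩
  have hψ : (ZMod.stdAddChar (N := p)).IsPrimitive := ZMod.isPrimitive_stdAddChar p
  generalize (ZMod.stdAddChar (N := p)) = ψ at hψ
  have hG : ∃ ε : ℤ, (ε = 1 ∨ ε = -1) ∧ auxG (F := F) ψ = ε * p * (p : ℂ) ^ k := by
    have h := aux_G hp2 hme hcard ψ hψ
    have h' : (auxG (F := F) ψ) ^ 2 = ((p : ℂ) ^ (k + 1)) ^ 2 := by rw [h]; ring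
    rcases sq_eq_sq_iff_eq_or_eq_neg.1 h' with h | h
    · exact ⟨1, Or.inl rfl, by rw [h]; push_cast; ring⟩
    · exact ⟨-1, Or.inr rfl, by rw [h]; push_cast; ring⟩
  obtain ⟨ε, hε, hG⟩ := hG
  have hfib : ∀ s : ZMod p, (univ.filter fun x : F => Algebra.trace (ZMod p) F x = s).card =
      p * (p ^ k) ^ 2 := by
    intro s
    have h := aux_fib hcard ψ hψ s
    have h2 : (p : ℂ) ^ (2 * k + 2) = p * (p * (p ^ k) ^ 2) := by ring
    rw [h2] at h
    exact_mod_cast mul_left_cancel₀ hp0 h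
  refine ⟨ε, hε, ?_, ?_, ?_⟩
  · intro a ha
    have hN : ∀ s : ZMod p, s ≠ 0 →
        ((univ.filter fun x : F => Algebra.trace (ZMod p) F x = s ∧
          Algebra.trace (ZMod p) F (a * x ^ 2) ≠ 0).card : ℤ) = (((p : ℤ) - 1) * (p ^ k) ^ 2 -
        (if Algebra.trace (ZMod p) F a⁻¹ = 0 then 0 else quadraticChar F a * ε * p ^ k)) := by
      intro s hs
      have h := aux_N hp2 hme hcard ψ hψ a ha s hs
      rw [hG] at h
      have h3 : ((univ.filter fun x : F => Algebra.trace (ZMod p) F x = s ∧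
          Algebra.trace (ZMod p) F (a * x ^ 2) = 0).card : ℤ) = (p ^ k) ^ 2 +
          (if Algebra.trace (ZMod p) F a⁻¹ = 0 then 0 else quadraticChar F a * ε * p ^ k) := by
        have h4 : (p : ℂ) ^ 2 * ((univ.filter fun x : F => Algebra.trace (ZMod p) F x = s ∧
            Algebra.trace (ZMod p) F (a * x ^ 2) = 0).card : ℂ) = (p : ℂ) ^ 2 * ((p ^ k) ^ 2 +
          (if Algebra.trace (ZMod p) F a⁻¹ = 0 then 0 else
            ((quadraticChar F a : ℤ) : ℂ) * ε * p ^ k)) := by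
          rw [h]
          split_ifs <;> ring
        have h5 := mul_left_cancel₀ (pow_ne_zero 2 hp0) h4
        split_ifs at h5 ⊢ <;> exact_mod_cast h5
      have h6 := Finset.card_filter_add_card_filter_not
        (s := univ.filter fun x : F => Algebra.trace (ZMod p) F x = s)
        (fun x => Algebra.trace (ZMod p) F (a * x ^ 2) = 0)
      rw [Finset.filter_filter, Finset.filter_filter, hfib s] at h6
      zify at h6
      rw [h3] at h6
      linarith
    have hw : wtD p F a = (univ.filter fun x : F => (IsSquare (Algebra.trace (ZMod p) F x) ∧
        Algebra.trace (ZMod p) F x ≠ 0) ∧ Algebra.trace (ZMod p) F (a * x ^ 2) ≠ 0).card := by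
      rw [wtD, ← Set.ncard_coe_finset]
      congr 1
      ext x
      simp only [Set.mem_setOf_eq, Finset.coe_filter, Finset.mem_univ, true_and]
      constructor
      · rintro ⟨⟨_, h2⟩, h3⟩
        exact ⟨h2, h3⟩
      · rintro ⟨h2, h3⟩
        refine ⟨⟨?_, h2⟩, h3⟩
        rintro rfl
        simp at h2
    rw [hw, Finset.card_eq_sum_card_fiberwise (f := fun x => Algebra.trace (ZMod p) F x)
      (t := univ.filter fun s : ZMod p => IsSquare s ∧ s ≠ 0)]
    · push_cast
      rw [Finset.sum_congr rfl (g := fun _ => (((p : ℤ) - 1) * (p ^ k) ^ 2 -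
        (if Algebra.trace (ZMod p) F a⁻¹ = 0 then 0 else quadraticChar F a * ε * p ^ k)))]
      · rw [Finset.sum_const, aux_cardsq hp2, nsmul_eq_mul]
        push_cast
        rfl
      · intro s hs
        have hs' := (Finset.mem_filter.1 hs).2
        rw [← hN s hs'.2, Finset.filter_filter]
        congr 2
        ext x
        simp only [Finset.mem_filter, Finset.mem_univ, true_and]
        constructor
        · rintro ⟨⟨_, h2⟩, h3⟩
          exact ⟨h3, h2⟩
        · rintro ⟨rfl, h2⟩
          exact ⟨⟨hs', h2⟩, rfl⟩
    · intro x hx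
      simp only [Finset.coe_filter, Finset.mem_univ, true_and, Set.mem_setOf_eq] at hx ⊢
      exact hx.1
  · have h := aux_etasum hp2 hme hcard ψ hψ
    rw [hG] at h
    have h2 : ((p : ℂ) - 1) * (ε * p * (p : ℂ) ^ k) = p * (((p : ℂ) - 1) * ε * p ^ k) := by ring
    rw [h2] at h
    have h5 := mul_left_cancel₀ hp0 h
    exact_mod_cast h5
  · rw [← hfib 0, Finset.card_filter, Finset.card_filter]
    exact Fintype.sum_equiv (Equiv.inv _) _ _ fun x => by simp only [Equiv.inv_apply]

theorem aux_count (hp2 : p ≠ 2) (k : ℕ) (hcard : Fintype.card F = p ^ (2 * k + 2)) (ε : ℤ)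
    (h1 : ∑ x ∈ univ.filter (fun x : F => Algebra.trace (ZMod p) F x⁻¹ = 0), quadraticChar F x =
        ((p : ℤ) - 1) * ε * p ^ k)
    (h2 : (univ.filter (fun x : F => Algebra.trace (ZMod p) F x⁻¹ = 0)).card = p * (p ^ k) ^ 2)
    (δ : ℤ) (hδ : δ = 1 ∨ δ = -1) :
    2 * ((univ.filter fun a : F => Algebra.trace (ZMod p) F a⁻¹ ≠ 0 ∧
      quadraticChar F a = δ).card : ℤ) = ((p : ℤ) - 1) * (p * (p ^ k) ^ 2 - δ * ε * p ^ k) := by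
  have hF : ringChar F ≠ 2 := aux_char hp2
  have e1 : 2 * ((univ.filter fun a : F => Algebra.trace (ZMod p) F a⁻¹ ≠ 0 ∧
      quadraticChar F a = δ).card : ℤ) =
      ∑ a ∈ univ.filter (fun x : F => ¬ Algebra.trace (ZMod p) F x⁻¹ = 0),
        (1 + δ * quadraticChar F a) := by
    rw [Finset.natCast_card_filter, Finset.mul_sum, Finset.sum_filter]
    refine Finset.sum_congr rfl fun a _ => ?_
    by_cases h : Algebra.trace (ZMod p) F a⁻¹ = 0
    · simp [h]
    · have ha : a ≠ 0 := by rintro rfl; simp at h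
      simp only [ne_eq, h, not_false_eq_true, true_and, if_true]
      rcases hδ with rfl | rfl <;> rcases quadraticChar_dichotomy ha with h | h <;> rw [h] <;> norm_num
  have e2 := Finset.card_filter_add_card_filter_not (s := (univ : Finset F))
    (fun x : F => Algebra.trace (ZMod p) F x⁻¹ = 0)
  have e3 := Finset.sum_filter_add_sum_filter_not (univ : Finset F)
    (fun x : F => Algebra.trace (ZMod p) F x⁻¹ = 0) (fun x => quadraticChar F x)
  rw [quadraticChar_sum_zero hF, h1] at e3
  rw [h2, Finset.card_univ, hcard] at e2
  zify at e2
  rw [e1, Finset.sum_add_distrib, ← Finset.mul_sum, Finset.sum_const, nsmul_eq_mul, mul_one]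
  have e4 : (p : ℤ) ^ (2 * k + 2) = p * (p * (p ^ k) ^ 2) := by ring
  rw [e4] at e2
  linear_combination e2 + δ * e3

end

/-- the weight distribution of `C_D` for `m` even. -/
theorem stmt_7 (p m : ℕ) [Fact p.Prime] (hp2 : p ≠ 2) (hm : 2 ≤ m) (hme : Even m)
    (F : Type) [Field F] [Fintype F] [Algebra (ZMod p) F]
    (hcard : Fintype.card F = p ^ m) :
    Set.ncard {a : F | wtD p F a = (p - 1) ^ 2 * p ^ (m - 2) / 2} = p ^ (m - 1) - 1 ∧
    Set.ncard {a : F | wtD p F a = (p - 1) / 2 * ((p - 1) * p ^ (m - 2) + p ^ ((m - 2) / 2))}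
      = (p - 1) / 2 * (p ^ (m - 1) + p ^ ((m - 2) / 2)) ∧
    Set.ncard {a : F | wtD p F a = (p - 1) / 2 * ((p - 1) * p ^ (m - 2) - p ^ ((m - 2) / 2))}
      = (p - 1) / 2 * (p ^ (m - 1) - p ^ ((m - 2) / 2)) ∧
    Set.ncard {a : F | wtD p F a = 0} = 1 ∧
    (∀ a : F, wtD p F a = 0 ∨
      wtD p F a = (p - 1) ^ 2 * p ^ (m - 2) / 2 ∨
      wtD p F a = (p - 1) / 2 * ((p - 1) * p ^ (m - 2) + p ^ ((m - 2) / 2)) ∨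
      wtD p F a = (p - 1) / 2 * ((p - 1) * p ^ (m - 2) - p ^ ((m - 2) / 2))) := by
  classical
  obtain ⟨k, rfl⟩ : ∃ k, m = 2 * k + 2 := by
    obtain ⟨j, rfl⟩ := hme
    exact ⟨j - 1, by omega⟩
  obtain ⟨ε, hε, hwt, hs, hc⟩ := aux_main hp2 k hcard
  have hcount := aux_count hp2 k hcard ε hs hc
  obtain ⟨q, hq⟩ := (Fact.out : p.Prime).odd_of_ne_two hp2
  have hq1 : 1 ≤ q := by have := (Fact.out : p.Prime).two_le; omega
  have hq' : (p - 1) / 2 = q := by omega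
  have hp1 : p - 1 = 2 * q := by omega
  have hpz : (p : ℤ) - 1 = 2 * q := by subst hq; push_cast; ring
  have e1 : p ^ (2 * k + 2 - 2) = (p ^ k) ^ 2 := by
    rw [Nat.add_sub_cancel]; ring
  have e2 : (2 * k + 2 - 2) / 2 = k := by omega
  have e3 : p ^ (2 * k + 2 - 1) = p * (p ^ k) ^ 2 := by
    have : 2 * k + 2 - 1 = 2 * k + 1 := by omega
    rw [this]; ring
  rw [e1, e2, e3, hp1]
  rw [hq'] at hwt
  rw [show 2 * q / 2 = q by omega]
  rw [hpz] at hwt hs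
  have hP : 1 ≤ p ^ k := Nat.one_le_pow _ _ (Fact.out : p.Prime).pos
  simp only [hpz] at hcount
  have hcz : ∀ n : ℕ, ((p ^ n : ℕ) : ℤ) = (p : ℤ) ^ n := fun n => by push_cast; rfl
  simp only [← hcz] at hwt hcount
  have hpP : 1 ≤ p := by omega
  have hw0 : wtD p F 0 = 0 := by
    rw [wtD]; simp
  set P := p ^ k with hPdef
  clear_value P
  obtain ⟨u, hu⟩ : ∃ u, u = q * P := ⟨_, rfl⟩
  obtain ⟨v, hv⟩ : ∃ v, v = q * (2 * q * P ^ 2) := ⟨_, rfl⟩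
  have hu1 : 1 ≤ u := by rw [hu]; exact Nat.mul_pos hq1 hP
  have hPP : 2 * P ≤ 2 * q * P ^ 2 := by nlinarith
  have hv1 : 2 * u ≤ v := by rw [hu, hv]; nlinarith
  have w1 : (2 * q) ^ 2 * P ^ 2 / 2 = v := by
    rw [hv, show (2 * q) ^ 2 * P ^ 2 = 2 * (q * (2 * q * P ^ 2)) by ring]; simp
  have w2 : q * (2 * q * P ^ 2 + P) = v + u := by rw [hu, hv]; ring
  have w3 : q * (2 * q * P ^ 2 - P) = v - u := by rw [hu, hv, Nat.mul_sub]
  rw [w1, w2, w3]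
  have c0 : ∀ a : F, a ≠ 0 → Algebra.trace (ZMod p) F a⁻¹ = 0 → wtD p F a = v := by
    intro a ha hT
    have h := hwt a ha
    rw [if_pos hT] at h
    zify
    rw [h, hv]; push_cast; ring
  have c1 : ∀ a : F, Algebra.trace (ZMod p) F a⁻¹ ≠ 0 →
      (quadraticChar F a = -ε ∧ wtD p F a = v + u) ∨
      (quadraticChar F a = ε ∧ wtD p F a = v - u) := by
    intro a hT
    have ha : a ≠ 0 := by rintro rfl; simp at hT
    have h := hwt a ha
    rw [if_neg hT] at h
    have hvz : (v : ℤ) = q * (2 * q * P ^ 2) := by rw [hv]; push_cast; ring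
    have huz : (u : ℤ) = q * P := by rw [hu]; push_cast; ring
    have hcase : quadraticChar F a = -ε ∨ quadraticChar F a = ε := by
      rcases hε with rfl | rfl <;> rcases quadraticChar_dichotomy ha with h | h <;> simp [h]
    have hε2 : ε * ε = 1 := by rcases hε with rfl | rfl <;> norm_num
    rcases hcase with h' | h'
    · left
      refine ⟨h', ?_⟩
      rw [h'] at h
      have : (wtD p F a : ℤ) = v + u := by
        rw [h, hvz, huz]; linear_combination (q : ℤ) * P * hε2
      omega
    · right
      refine ⟨h', ?_⟩
      rw [h'] at h
      have : (wtD p F a : ℤ) = v - u := by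
        rw [h, hvz, huz]; linear_combination -(q : ℤ) * P * hε2
      omega
  have hεne : -ε ≠ ε := by rcases hε with rfl | rfl <;> norm_num
  have hε2 : ε * ε = 1 := by rcases hε with rfl | rfl <;> norm_num
  refine ⟨?_, ?_, ?_, ?_, ?_⟩
  · have : {a : F | wtD p F a = v} =
        ((univ.filter (fun x : F => Algebra.trace (ZMod p) F x⁻¹ = 0)).erase 0 : Finset F) := by
      ext a
      simp only [Set.mem_setOf_eq, Finset.coe_erase, Finset.coe_filter, Finset.mem_univ, true_and,
        Set.mem_diff, Set.mem_singleton_iff]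
      by_cases hT : Algebra.trace (ZMod p) F a⁻¹ = 0
      · by_cases ha : a = 0
        · subst ha
          simp only [hw0, not_true_eq_false, and_false, iff_false]
          omega
        · simp [hT, ha, c0 a ha hT]
      · simp only [hT, false_and, iff_false]
        rcases c1 a hT with h | h <;> omega
    rw [this, Set.ncard_coe_finset, Finset.card_erase_of_mem (by simp), hc]
  · have : {a : F | wtD p F a = v + u} =
        ((univ.filter fun a : F => Algebra.trace (ZMod p) F a⁻¹ ≠ 0 ∧
      quadraticChar F a = -ε) : Finset F) := by
      ext a
      simp only [Set.mem_setOf_eq, Finset.coe_filter, Finset.mem_univ, true_and]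
      by_cases hT : Algebra.trace (ZMod p) F a⁻¹ = 0
      · simp only [hT, ne_eq, not_true_eq_false, false_and, iff_false]
        by_cases ha : a = 0
        · subst ha
          omega
        · have := c0 a ha hT
          omega
      · simp only [hT, ne_eq, not_false_eq_true, true_and]
        rcases c1 a hT with h | h <;> omega
    rw [this, Set.ncard_coe_finset]
    have h := hcount (-ε) (by rcases hε with rfl | rfl <;> simp)
    zify
    have h2 : (2 : ℤ) * ((univ.filter fun a : F => Algebra.trace (ZMod p) F a⁻¹ ≠ 0 ∧
      quadraticChar F a = -ε).card : ℤ) = 2 * (q * (p * P ^ 2 + P)) := by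
      linear_combination h + 2 * (q : ℤ) * P * hε2
    exact mul_left_cancel₀ two_ne_zero h2
  · have : {a : F | wtD p F a = v - u} =
        ((univ.filter fun a : F => Algebra.trace (ZMod p) F a⁻¹ ≠ 0 ∧
      quadraticChar F a = ε) : Finset F) := by
      ext a
      simp only [Set.mem_setOf_eq, Finset.coe_filter, Finset.mem_univ, true_and]
      by_cases hT : Algebra.trace (ZMod p) F a⁻¹ = 0
      · simp only [hT, ne_eq, not_true_eq_false, false_and, iff_false]
        by_cases ha : a = 0
        · subst ha
          omega
        · have := c0 a ha hT
          omega
      · simp only [hT, ne_eq, not_false_eq_true, true_and]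
        rcases c1 a hT with h | h <;> omega
    rw [this, Set.ncard_coe_finset]
    have h := hcount ε hε
    have hle : P ≤ p * P ^ 2 := by nlinarith
    zify [hle]
    have h2 : (2 : ℤ) * ((univ.filter fun a : F => Algebra.trace (ZMod p) F a⁻¹ ≠ 0 ∧
      quadraticChar F a = ε).card : ℤ) = 2 * (q * (p * P ^ 2 - P)) := by
      linear_combination h - 2 * (q : ℤ) * P * hε2
    exact mul_left_cancel₀ two_ne_zero h2
  · have : {a : F | wtD p F a = 0} = {0} := by
      ext a
      simp only [Set.mem_setOf_eq, Set.mem_singleton_iff]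
      constructor
      · intro h0
        by_contra ha
        by_cases hT : Algebra.trace (ZMod p) F a⁻¹ = 0
        · have := c0 a ha hT
          omega
        · rcases c1 a hT with h | h <;> omega
      · rintro rfl
        exact hw0
    rw [this, Set.ncard_singleton]
  · intro a
    by_cases ha : a = 0
    · subst ha; exact Or.inl hw0
    · by_cases hT : Algebra.trace (ZMod p) F a⁻¹ = 0
      · exact Or.inr (Or.inl (c0 a ha hT))
      · rcases c1 a hT with h | h
        · exact Or.inr (Or.inr (Or.inl h.2))
        · exact Or.inr (Or.inr (Or.inr h.2))
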